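/- Let Λ be a maximal invariant lattice in V. Then Λ/πΛ is indecomposable as an F[G]-module: it is nonzero, and it is not the internal direct sum of two nonzero F[G]-submodules. -/

import Mathlib

noncomputable section

attribute [local instance] Classical.propDecidable

open Pointwise

/-! ### Generic machinery: modules equipped with a family of endomorphisms
indexed by a group `G` (i.e. "`R[G]`-modules"). -/

section Generic

variable {R : Type*} [CommRing R] {M : Type*} [AddCommGroup M] [Module R M]
variable {G : Type*}

/-- A submodule stable under all the endomorphisms `σ g`. -/
def ActStable (σ : G → M →ₗ[R] M) (W : Submodule R M) : Prop :=
  ∀ g : G, ∀ x ∈ W, σ g x ∈ W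

/-- The subquotient `W₂ / W₁`. -/
abbrev SubQuot (W₁ W₂ : Submodule R M) : Type _ :=
  W₂ ⧸ (W₁.comap W₂.subtype)

/-- The endomorphism of `W₂/W₁` induced by `σ g` (junk value `0` if `σ g` does not
preserve `W₁` and `W₂`). -/
noncomputable def subQuotMap (σ : G → M →ₗ[R] M) (W₁ W₂ : Submodule R M) (g : G) :
    SubQuot W₁ W₂ →ₗ[R] SubQuot W₁ W₂ :=
  if h : (∀ x ∈ W₂, σ g x ∈ W₂) ∧ ∀ x ∈ W₂, x ∈ W₁ → σ g x ∈ W₁ then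
    Submodule.mapQ _ _ ((σ g).restrict (p := W₂) (q := W₂) h.1)
      (by intro x hx; exact h.2 x x.2 hx)
  else 0

/-- The endomorphism of a stable submodule `W` induced by `σ g`. -/
noncomputable def subAct (σ : G → M →ₗ[R] M) (W : Submodule R M) (g : G) : W →ₗ[R] W :=
  if h : ∀ x ∈ W, σ g x ∈ W then (σ g).restrict h else 0

/-- The endomorphism of `M ⧸ W` induced by `σ g`. -/
noncomputable def quotMap (σ : G → M →ₗ[R] M) (W : Submodule R M) (g : G) :
    (M ⧸ W) →ₗ[R] (M ⧸ W) :=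
  if h : W ≤ W.comap (σ g) then Submodule.mapQ W W (σ g) h else 0

/-- Two modules-with-`G`-action are isomorphic: there is a linear equivalence
commuting with the two actions. -/
def IsRepIso {N : Type*} [AddCommGroup N] [Module R N]
    (σ : G → M →ₗ[R] M) (τ : G → N →ₗ[R] N) : Prop :=
  ∃ e : M ≃ₗ[R] N, ∀ (g : G) (x : M), e (σ g x) = τ g (e x)

/-- `M` with the action `σ` is a simple module-with-action. -/
def IsSimpleAct (σ : G → M →ₗ[R] M) : Prop :=
  Nontrivial M ∧ ∀ W : Submodule R M, ActStable σ W → W = ⊥ ∨ W = ⊤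

/-- `W` is a simple stable submodule of `M`. -/
def IsSimpleSubmodule (σ : G → M →ₗ[R] M) (W : Submodule R M) : Prop :=
  ActStable σ W ∧ W ≠ ⊥ ∧ ∀ U : Submodule R M, ActStable σ U → U ≤ W → U = ⊥ ∨ U = W

/-- The socle: the sum of all simple stable submodules. -/
def actSocle (σ : G → M →ₗ[R] M) : Submodule R M :=
  sSup {W | IsSimpleSubmodule σ W}

/-- The socle filtration: `socFilt σ 0 = ⊥` and `socFilt σ (k+1)` is the preimage in `M`
of the socle of `M / socFilt σ k`. -/
noncomputable def socFilt (σ : G → M →ₗ[R] M) : ℕ → Submodule R M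
  | 0 => ⊥
  | k + 1 => (actSocle (quotMap σ (socFilt σ k))).comap (socFilt σ k).mkQ

/-- `(A₁, A₂)` is a sharp subquotient: every stable submodule strictly containing `A₁`
contains `A₂`. -/
def IsSharp (σ : G → M →ₗ[R] M) (A₁ A₂ : Submodule R M) : Prop :=
  ActStable σ A₁ ∧ ActStable σ A₂ ∧ A₁ < A₂ ∧
    ∀ W : Submodule R M, ActStable σ W → A₁ < W → A₂ ≤ W

/-- `(A₁, A₂)` is an irreducible subquotient: `A₂/A₁` is simple, i.e. there is no stable
submodule strictly between `A₁` and `A₂`. -/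
def IsIrredSubquot (σ : G → M →ₗ[R] M) (A₁ A₂ : Submodule R M) : Prop :=
  ActStable σ A₁ ∧ ActStable σ A₂ ∧ A₁ < A₂ ∧
    ∀ W : Submodule R M, ActStable σ W → A₁ ≤ W → W ≤ A₂ → W = A₁ ∨ W = A₂

end Generic

/-! ### Lattices in representations over a discretely valued field -/

section LatticeDefs

variable {O : Type*} [CommRing O]
variable {V : Type*} [AddCommGroup V] [Module O V]

/-- A lattice: a finitely generated `O`-submodule of `V` spanning `V` over `K`. -/
def IsLattice (K : Type*) [Field K] [Module K V] (Λ : Submodule O V) : Prop :=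
  Λ.FG ∧ Submodule.span K (Λ : Set V) = ⊤

/-- Two lattices are homothetic: `Λ' = λ • Λ` for some nonzero `λ ∈ K`. -/
def Homothetic (K : Type*) [Field K] [SMul K V] (Λ Λ' : Submodule O V) : Prop :=
  ∃ lam : K, lam ≠ 0 ∧ (Λ' : Set V) = lam • (Λ : Set V)

end LatticeDefs

section Lattices

variable {O : Type*} [CommRing O] [IsDomain O] [IsDiscreteValuationRing O]
variable {K : Type*} [Field K] [Algebra O K] [IsFractionRing O K]
variable {G : Type*} [Group G]
variable {V : Type*} [AddCommGroup V] [Module K V] [Module O V] [IsScalarTower O K V]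

/-- The submodule `πΛ`. -/
def piSmul (π : O) (Λ : Submodule O V) : Submodule O V :=
  Λ.map (LinearMap.lsmul O V π)

/-- The `O`-linear `G`-action on `V`. -/
def resAct (ρ : Representation K G V) : G → V →ₗ[O] V :=
  fun g => (ρ g).restrictScalars O

/-- `Λ` is invariant: `gΛ = Λ` for all `g ∈ G`. -/
def IsInvariantSub (ρ : Representation K G V) (Λ : Submodule O V) : Prop :=
  ∀ g : G, Λ.map (resAct ρ g) = Λ

/-- `Λ` is normalised at `v`: `v ∈ Λ` and `v ∉ πΛ`. -/
def IsNormalizedAt (π : O) (Λ : Submodule O V) (v : V) : Prop :=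
  v ∈ Λ ∧ v ∉ piSmul π Λ

/-- `Λ` is an invariant lattice, normalised at `v`, maximal under inclusion among
invariant lattices normalised at `v`. -/
def IsMaximalAt (ρ : Representation K G V) (π : O) (Λ : Submodule O V) (v : V) : Prop :=
  IsLattice K Λ ∧ IsInvariantSub ρ Λ ∧ IsNormalizedAt π Λ v ∧
    ∀ Λ' : Submodule O V, IsLattice K Λ' → IsInvariantSub ρ Λ' → IsNormalizedAt π Λ' v →
      Λ ≤ Λ' → Λ' = Λ

/-- `Λ` is a maximal invariant lattice: maximal with respect to some nonzero `v`. -/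
def IsMaximalLattice (ρ : Representation K G V) (π : O) (Λ : Submodule O V) : Prop :=
  ∃ v : V, v ≠ 0 ∧ IsMaximalAt ρ π Λ v

/-- `V` is simple as a `K[G]`-module. -/
def IsIrreducibleRep (ρ : Representation K G V) : Prop :=
  Nontrivial V ∧ ∀ W : Submodule K V, (∀ g : G, ∀ x ∈ W, ρ g x ∈ W) → W = ⊥ ∨ W = ⊤

/-- The induced `G`-action on the reduction `Λ/πΛ`. -/
noncomputable def redAct (ρ : Representation K G V) (π : O) (Λ : Submodule O V) :
    G → SubQuot (piSmul π Λ) Λ →ₗ[O] SubQuot (piSmul π Λ) Λ :=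
  subQuotMap (resAct ρ) (piSmul π Λ) Λ

/-- The map `Λ/πΛ → Λ'/πΛ'` induced by an inclusion `Λ ≤ Λ'` (junk value `0` if
`Λ ≰ Λ'`). -/
noncomputable def redMap (π : O) (Λ Λ' : Submodule O V) :
    SubQuot (piSmul π Λ) Λ →ₗ[O] SubQuot (piSmul π Λ') Λ' :=
  if h : Λ ≤ Λ' then
    Submodule.mapQ _ _ (Submodule.inclusion h)
      (by
        intro x hx
        have hx' : (x : V) ∈ piSmul π Λ := hx
        have : (x : V) ∈ piSmul π Λ' := Submodule.map_mono h hx'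
        simpa [Submodule.mem_comap] using this)
  else 0

/-- `ρ` realises a non-split extension of `A` (a module with action `τA`) by `B`
(a module with action `τB`): there are an invariant lattice `L` and submodules
`U₀ ⊆ T ⊆ U₁` of `L/πL` with `T/U₀ ≅ B`, `U₁/T ≅ A`, and `T/U₀` has no stable
complement in `U₁/U₀` (i.e. the extension `0 → B → U₁/U₀ → A → 0` does not split). -/
def RealizesExt (ρ : Representation K G V) (π : O)
    {NA : Type*} [AddCommGroup NA] [Module O NA] {NB : Type*} [AddCommGroup NB] [Module O NB]
    (τA : G → NA →ₗ[O] NA) (τB : G → NB →ₗ[O] NB) : Prop :=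
  ∃ L : Submodule O V, IsLattice K L ∧ IsInvariantSub ρ L ∧
    ∃ U₀ U₁ T : Submodule O (SubQuot (piSmul π L) L),
      ActStable (redAct ρ π L) U₀ ∧ ActStable (redAct ρ π L) U₁ ∧
      ActStable (redAct ρ π L) T ∧ U₀ ≤ T ∧ T ≤ U₁ ∧
      IsRepIso (subQuotMap (redAct ρ π L) U₀ T) τB ∧
      IsRepIso (subQuotMap (redAct ρ π L) T U₁) τA ∧
      ¬ ∃ C : Submodule O (SubQuot (piSmul π L) L), ActStable (redAct ρ π L) C ∧
          U₀ ≤ C ∧ C ≤ U₁ ∧ C ⊓ T = U₀ ∧ C ⊔ T = U₁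

end Lattices

/-- The underlying family of linear endomorphisms of a representation. -/
def ofRep {R : Type*} [CommSemiring R] {G : Type*} [Monoid G] {M : Type*} [AddCommMonoid M]
    [Module R M] (σ : Representation R G M) : G → M →ₗ[R] M := fun g => σ g

section Indecomposable

variable {O : Type*} [CommRing O] {K : Type*} [Field K] [Algebra O K]
variable {G : Type*} [Group G]
variable {V : Type*} [AddCommGroup V] [Module K V] [Module O V] [IsScalarTower O K V]

/-- A submodule mapped into itself by every group element is invariant. -/
theorem isInvariantSub_of_actStable (ρ : Representation K G V) (Λ : Submodule O V)
    (h : ActStable (resAct ρ) Λ) : IsInvariantSub ρ Λ := by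
  intro g
  refine le_antisymm (Submodule.map_le_iff_le_comap.2 (h g)) fun x hx => ?_
  exact ⟨resAct ρ g⁻¹ x, h g⁻¹ x hx, ρ.self_inv_apply g x⟩

theorem IsInvariantSub.actStable {ρ : Representation K G V} {Λ : Submodule O V}
    (h : IsInvariantSub ρ Λ) : ActStable (resAct ρ) Λ :=
  fun g _ hx => h g ▸ Submodule.mem_map_of_mem hx

/-- The induced action on the reduction of an invariant lattice is computed on representatives. -/
theorem redAct_mk {ρ : Representation K G V} {Λ : Submodule O V} (π : O)
    (h : ActStable (resAct ρ) Λ) (g : G) (x : Λ) :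
    redAct ρ π Λ g (Submodule.Quotient.mk x) =
      Submodule.Quotient.mk ⟨resAct ρ g x, h g x x.2⟩ := by
  have hg : (∀ x ∈ Λ, resAct (O := O) ρ g x ∈ Λ) ∧
      ∀ x ∈ Λ, x ∈ piSmul π Λ → resAct (O := O) ρ g x ∈ piSmul π Λ := by
    refine ⟨h g, ?_⟩
    rintro _ - ⟨y, hy, rfl⟩
    exact ⟨resAct ρ g y, h g y hy, ((resAct ρ g).map_smul π y).symm⟩
  rw [redAct, subQuotMap, dif_pos hg]
  rfl

/-- The preimage in `V` of a submodule of the reduction `Λ / πΛ`. -/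
def reductionPreimage (π : O) (Λ : Submodule O V) (A : Submodule O (SubQuot (piSmul π Λ) Λ)) :
    Submodule O V :=
  (A.comap (Submodule.mkQ _)).map Λ.subtype

/-- A nonzero scalar of `O` acts bijectively on a vector space over the fraction field. -/
theorem lsmul_bijective {O : Type*} [CommRing O] (K : Type*) [Field K] [Algebra O K]
    [IsFractionRing O K] (V : Type*) [AddCommGroup V] [Module K V] [Module O V]
    [IsScalarTower O K V] {c : O} (hc : c ≠ 0) : Function.Bijective (LinearMap.lsmul O V c) := by
  have hcK : IsUnit (algebraMap O K c) :=
    ((map_ne_zero_iff _ (IsFractionRing.injective O K)).2 hc).isUnit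
  have h : ⇑(LinearMap.lsmul O V c) = fun x : V => algebraMap O K c • x :=
    funext fun x => (algebraMap_smul K c x).symm
  rw [h]
  exact hcK.smul_bijective

/-- If `Λ` is maximal at `v`, every nonzero stable submodule of `Λ / πΛ` contains
the class of `v`. -/
theorem IsMaximalAt.mk_mem_of_ne_bot [IsDomain O] [IsDiscreteValuationRing O]
    [IsFractionRing O K] {π : O} (hπ : Irreducible π) {ρ : Representation K G V}
    {Λ : Submodule O V} {v : V} (hmax : IsMaximalAt ρ π Λ v)
    {A : Submodule O (SubQuot (piSmul π Λ) Λ)} (hA : ActStable (redAct ρ π Λ) A)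
    (hA0 : A ≠ ⊥) :
    (Submodule.Quotient.mk ⟨v, hmax.2.2.1.1⟩ : SubQuot (piSmul π Λ) Λ) ∈ A := by
  obtain ⟨⟨hfg, hspan⟩, hinv, ⟨hvΛ, -⟩, hmaxΛ⟩ := hmax
  have hst := hinv.actStable
  have hbij := lsmul_bijective K V hπ.ne_zero
  set P := reductionPreimage π Λ A
  have hPΛ : P ≤ Λ := Submodule.map_subtype_le _ _
  set Λ' := P.comap (LinearMap.lsmul O V π)
  have hle : Λ ≤ Λ' := by
    intro x hx
    refine ⟨⟨π • x, Λ.smul_mem π hx⟩, ?_, rfl⟩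
    have h0 : (Submodule.Quotient.mk ⟨π • x, Λ.smul_mem π hx⟩ : SubQuot (piSmul π Λ) Λ) = 0 :=
      (Submodule.Quotient.mk_eq_zero _).2 ⟨x, hx, rfl⟩
    change Submodule.Quotient.mk _ ∈ A
    rw [h0]
    exact A.zero_mem
  have hpi : piSmul π Λ' = P := Submodule.map_comap_eq_of_surjective hbij.2 P
  have hlat : IsLattice K Λ' := by
    refine ⟨Submodule.fg_of_fg_map_injective _ hbij.1 ?_,
      top_unique (hspan ▸ Submodule.span_mono hle)⟩
    have : IsNoetherian O Λ := isNoetherian_of_fg_of_noetherian Λ hfg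
    exact (isNoetherian_submodule.1 this) _ (hpi.le.trans hPΛ)
  have hPst : ActStable (resAct ρ) P := by
    rintro g _ ⟨x, hx, rfl⟩
    refine ⟨⟨resAct ρ g x, hst g x x.2⟩, ?_, rfl⟩
    change Submodule.Quotient.mk _ ∈ A
    rw [← redAct_mk π hst g x]
    exact hA g _ hx
  have hinv' : IsInvariantSub ρ Λ' := by
    refine isInvariantSub_of_actStable ρ Λ' fun g x hx => ?_
    have h := hPst g _ hx
    rwa [LinearMap.lsmul_apply, map_smul] at h
  by_contra hv
  have hvP : v ∉ P := by
    rintro ⟨x, hx, rfl⟩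
    exact hv hx
  have heq : Λ' = Λ := hmaxΛ Λ' hlat hinv' ⟨hle hvΛ, fun h => hvP (hpi.le h)⟩ hle
  refine hA0 ((Submodule.eq_bot_iff A).2 fun a ha => ?_)
  obtain ⟨x, rfl⟩ := Submodule.Quotient.mk_surjective _ a
  refine (Submodule.Quotient.mk_eq_zero _).2 ?_
  rw [heq] at hpi
  exact hpi.ge ⟨x, ha, rfl⟩

end Indecomposable

section Statement

variable {O : Type*} [CommRing O] [IsDomain O] [IsDiscreteValuationRing O]
variable {K : Type*} [Field K] [Algebra O K] [IsFractionRing O K]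
variable {G : Type*} [Group G]
variable {V : Type*} [AddCommGroup V] [Module K V] [Module O V] [IsScalarTower O K V]
variable [FiniteDimensional K V]

theorem statement_15 (π : O) (hπ : Irreducible π) (ρ : Representation K G V)
    (Λ : Submodule O V) (hmax : IsMaximalLattice ρ π Λ) :
    Nontrivial (SubQuot (piSmul π Λ) Λ) ∧
      ¬ ∃ A B : Submodule O (SubQuot (piSmul π Λ) Λ),
          ActStable (redAct ρ π Λ) A ∧ ActStable (redAct ρ π Λ) B ∧
          A ≠ ⊥ ∧ B ≠ ⊥ ∧ A ⊓ B = ⊥ ∧ A ⊔ B = ⊤ := by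
  obtain ⟨v, -, hv⟩ := hmax
  have hv0 : (Submodule.Quotient.mk ⟨v, hv.2.2.1.1⟩ : SubQuot (piSmul π Λ) Λ) ≠ 0 :=
    fun h => hv.2.2.1.2
      ((Submodule.Quotient.mk_eq_zero ((piSmul π Λ).comap Λ.subtype)).1 h)
  refine ⟨nontrivial_of_ne _ _ hv0, ?_⟩
  rintro ⟨A, B, hA, hB, hA0, hB0, hAB, -⟩
  exact hv0 ((Submodule.mem_bot O).1 (hAB ▸
    ⟨hv.mk_mem_of_ne_bot hπ hA hA0, hv.mk_mem_of_ne_bot hπ hB hB0⟩))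

end Statement
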